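/- For every τ in the complex upper half-plane, ( θ[1/5,3/5](τ)·θ[1/5,1](τ)² + ζ₅²·θ[1/5,7/5](τ)²·θ[1/5,9/5](τ) )³ · ( ζ₅·θ[1/5,3/5](τ)·θ[1/5,7/5](τ)³ − ζ₅·θ[1/5,1](τ)³·θ[1/5,9/5](τ) ) = ( ζ₅³·θ[1/5,3/5](τ)²·θ[1/5,7/5](τ) + θ[1/5,1](τ)·θ[1/5,9/5](τ)² )³ · ( θ[1/5,3/5](τ)³·θ[1/5,1](τ) − ζ₅⁴·θ[1/5,7/5](τ)·θ[1/5,9/5](τ)³ ). -/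

import Mathlib

open Complex

/-- The theta constant with characteristic `[ε; ε']`:
`θ[ε,ε'](τ) = ∑_{n ∈ ℤ} exp(2πi((1/2)(n+ε/2)²τ + (n+ε/2)(ε'/2)))`. -/
noncomputable def θ (ε ε' : ℝ) (τ : ℂ) : ℂ :=
  ∑' n : ℤ, Complex.exp (2 * Real.pi * Complex.I *
    ((1 / 2) * ((n : ℂ) + (ε : ℂ) / 2) ^ 2 * τ + ((n : ℂ) + (ε : ℂ) / 2) * ((ε' : ℂ) / 2)))

/-- `ζ₅ = exp(2πi/5)`. -/
noncomputable def ζ₅ : ℂ := Complex.exp (2 * Real.pi * Complex.I / 5)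

/-- The splitting of `ℤ × ℤ` into pairs of equal and of opposite parity, each parametrised by
half-sum and half-difference. -/
noncomputable def intPairParityEquiv : (ℤ × ℤ) ⊕ (ℤ × ℤ) ≃ ℤ × ℤ :=
  Equiv.ofBijective
    (Sum.elim (fun p ↦ (p.1 + p.2, p.1 - p.2)) (fun p ↦ (p.1 + p.2 + 1, p.1 - p.2))) (by
      constructor
      · rintro (⟨a, b⟩ | ⟨a, b⟩) (⟨c, d⟩ | ⟨c, d⟩) h <;>
          simp only [Sum.elim_inl, Sum.elim_inr, Prod.mk.injEq, Sum.inl.injEq, Sum.inr.injEq,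
            reduceCtorEq] at h ⊢ <;> omega
      · rintro ⟨m, n⟩
        rcases Int.even_or_odd' (m + n) with ⟨k, hk | hk⟩
        · exact ⟨.inl (k, m - k), by
            simp only [Sum.elim_inl, Prod.mk.injEq]; omega⟩
        · exact ⟨.inr (k, k - n), by
            simp only [Sum.elim_inr, Prod.mk.injEq]; omega⟩)

lemma intPairParityEquiv_inl (p : ℤ × ℤ) :
    intPairParityEquiv (.inl p) = (p.1 + p.2, p.1 - p.2) := rfl

lemma intPairParityEquiv_inr (p : ℤ × ℤ) :
    intPairParityEquiv (.inr p) = (p.1 + p.2 + 1, p.1 - p.2) := rfl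

/-- The companion of `jacobiTheta₂ (2 * z) (2 * τ)` in the addition formula: the theta series
over half-integers. -/
noncomputable def halfTheta (z τ : ℂ) : ℂ :=
  cexp (2 * Real.pi * I * z + Real.pi * I * τ / 2) * jacobiTheta₂ (2 * z + τ) (2 * τ)

lemma im_two_mul_pos {τ : ℂ} (hτ : 0 < τ.im) : 0 < (2 * τ).im := by
  simpa using hτ

lemma jacobiTheta₂_add_mul_sub (x y : ℂ) {τ : ℂ} (hτ : 0 < τ.im) :
    jacobiTheta₂ (x + y) τ * jacobiTheta₂ (x - y) τ =
      jacobiTheta₂ (2 * x) (2 * τ) * jacobiTheta₂ (2 * y) (2 * τ) +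
        halfTheta x τ * halfTheta y τ := by
  have hs (z : ℂ) {σ : ℂ} (hσ : 0 < σ.im) : Summable fun n ↦ ‖jacobiTheta₂_term n z σ‖ :=
    ((summable_jacobiTheta₂_term_iff z σ).2 hσ).norm
  have h2 := im_two_mul_pos hτ
  have hsum := summable_mul_of_summable_norm (hs (x + y) hτ) (hs (x - y) hτ)
  have hsum' := intPairParityEquiv.summable_iff.2 hsum
  rw [halfTheta, halfTheta, mul_mul_mul_comm]
  simp only [jacobiTheta₂]
  rw [tsum_mul_tsum_of_summable_norm (hs _ hτ) (hs _ hτ),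
    tsum_mul_tsum_of_summable_norm (hs _ h2) (hs _ h2),
    tsum_mul_tsum_of_summable_norm (hs _ h2) (hs _ h2), ← tsum_mul_left,
    ← intPairParityEquiv.tsum_eq]
  refine (Summable.tsum_sum (hsum'.comp_injective Sum.inl_injective)
    (hsum'.comp_injective Sum.inr_injective)).trans ?_
  congr 1
  · refine tsum_congr fun p ↦ ?_
    simp only [Function.comp_apply, intPairParityEquiv_inl, jacobiTheta₂_term,
      ← Complex.exp_add]
    push_cast
    ring_nf
  · refine tsum_congr fun p ↦ ?_
    simp only [Function.comp_apply, intPairParityEquiv_inr, jacobiTheta₂_term,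
      ← Complex.exp_add]
    push_cast
    ring_nf

/-- The odd Jacobi theta function, up to a factor depending only on `τ`. -/
noncomputable def oddTheta (z τ : ℂ) : ℂ :=
  cexp (Real.pi * I * z) * jacobiTheta₂ (z + (1 + τ) / 2) τ

lemma oddTheta_add_one (z τ : ℂ) : oddTheta (z + 1) τ = -oddTheta z τ := by
  rw [oddTheta, oddTheta, add_right_comm, jacobiTheta₂_add_left, mul_add, Complex.exp_add,
    mul_one, Complex.exp_pi_mul_I]
  ring

lemma oddTheta_neg (z τ : ℂ) : oddTheta (-z) τ = -oddTheta z τ := by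
  have h1 : jacobiTheta₂ (-z + (1 + τ) / 2) τ = jacobiTheta₂ (z + (1 - τ) / 2) τ := by
    rw [← jacobiTheta₂_neg_left, ← jacobiTheta₂_add_left]
    ring_nf
  have h2 : jacobiTheta₂ (z + (1 + τ) / 2) τ =
      -cexp (-(2 * Real.pi * I * z)) * jacobiTheta₂ (z + (1 - τ) / 2) τ := by
    rw [show z + (1 + τ) / 2 = z + (1 - τ) / 2 + τ by ring, jacobiTheta₂_add_left',
      show -(Real.pi : ℂ) * I * (τ + 2 * (z + (1 - τ) / 2)) =
        -(2 * Real.pi * I * z) - Real.pi * I by ring, Complex.exp_sub, Complex.exp_pi_mul_I]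
    ring
  rw [oddTheta, oddTheta, h1, h2, neg_mul, mul_neg (cexp _), neg_neg, ← mul_assoc, ← Complex.exp_add]
  ring_nf

lemma oddTheta_add_mul_sub (x y : ℂ) {τ : ℂ} (hτ : 0 < τ.im) :
    oddTheta (x + y) τ * oddTheta (x - y) τ = cexp (-(Real.pi * I * τ / 2)) *
      (halfTheta x τ * jacobiTheta₂ (2 * y) (2 * τ) -
        jacobiTheta₂ (2 * x) (2 * τ) * halfTheta y τ) := by
  have hA : cexp (2 * Real.pi * I * x) * jacobiTheta₂ (2 * (x + (1 + τ) / 2)) (2 * τ) =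
      cexp (-(Real.pi * I * τ / 2)) * halfTheta x τ := by
    rw [show 2 * (x + (1 + τ) / 2) = 2 * x + τ + 1 by ring, jacobiTheta₂_add_left, halfTheta,
      ← mul_assoc, ← Complex.exp_add]
    ring_nf
  have hB : cexp (2 * Real.pi * I * x) * halfTheta (x + (1 + τ) / 2) τ =
      -(cexp (-(Real.pi * I * τ / 2)) * jacobiTheta₂ (2 * x) (2 * τ)) := by
    rw [halfTheta, show 2 * (x + (1 + τ) / 2) + τ = 2 * x + 2 * τ + 1 by ring,
      jacobiTheta₂_add_left, jacobiTheta₂_add_left', ← mul_assoc, ← mul_assoc,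
      ← Complex.exp_add, ← Complex.exp_add, ← neg_mul, ← neg_one_mul (cexp _),
      ← Complex.exp_pi_mul_I, ← Complex.exp_add]
    ring_nf
  have h := jacobiTheta₂_add_mul_sub (x + (1 + τ) / 2) y hτ
  have hexp : cexp (Real.pi * I * (x + y)) * cexp (Real.pi * I * (x - y)) =
      cexp (2 * Real.pi * I * x) := by
    rw [← Complex.exp_add]
    ring_nf
  rw [oddTheta, oddTheta, mul_mul_mul_comm, hexp,
    show x + y + (1 + τ) / 2 = x + (1 + τ) / 2 + y by ring,
    show x - y + (1 + τ) / 2 = x + (1 + τ) / 2 - y by ring, h]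
  linear_combination jacobiTheta₂ (2 * y) (2 * τ) * hA + halfTheta y τ * hB

/-- Weierstrass' three-term identity. -/
lemma oddTheta_three_term (x y z w : ℂ) {τ : ℂ} (hτ : 0 < τ.im) :
    oddTheta (x + y) τ * oddTheta (x - y) τ * (oddTheta (z + w) τ * oddTheta (z - w) τ) +
      oddTheta (x + z) τ * oddTheta (x - z) τ * (oddTheta (w + y) τ * oddTheta (w - y) τ) +
      oddTheta (x + w) τ * oddTheta (x - w) τ * (oddTheta (y + z) τ * oddTheta (y - z) τ) =
      0 := by
  simp only [oddTheta_add_mul_sub _ _ hτ]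
  ring

/-- The value of `oddTheta` at the `5`-torsion point `-2τ/5 + j/5`. -/
noncomputable def torsionTheta (j : ℤ) (τ : ℂ) : ℂ := oddTheta (-(2 * τ / 5) + j / 5) τ

lemma torsionTheta_neg_two_mul_first {τ : ℂ} (hτ : 0 < τ.im) :
    torsionTheta (-2) τ * (torsionTheta (-1) τ * torsionTheta 0 τ ^ 2 +
      torsionTheta 1 τ ^ 2 * torsionTheta 2 τ) =
    -(oddTheta (-(4 * τ / 5) + 1 / 5) τ * oddTheta (1 / 5) τ * oddTheta (2 / 5) τ ^ 2) := by
  have h := oddTheta_three_term (-(2 * τ / 5)) 0 (-(2 * τ / 5) + 1 / 5) (-(2 / 5)) hτ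
  have e1 := oddTheta_add_one (-(2 * τ / 5) - 2 / 5) τ
  have e2 := oddTheta_neg (-(2 * τ / 5) + 1 / 5) τ
  have e3 := oddTheta_neg (1 / 5) τ
  have e4 := oddTheta_neg (2 / 5) τ
  simp only [torsionTheta]
  push_cast
  ring_nf at h e1 e2 e3 e4 ⊢
  rw [e1, e2, e3, e4] at h
  linear_combination -h

lemma torsionTheta_neg_two_mul_second {τ : ℂ} (hτ : 0 < τ.im) :
    torsionTheta (-2) τ * (torsionTheta (-1) τ ^ 2 * torsionTheta 1 τ +
      torsionTheta 0 τ * torsionTheta 2 τ ^ 2) =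
    -(oddTheta (-(4 * τ / 5) + 1 / 5) τ * oddTheta (1 / 5) τ ^ 2 * oddTheta (2 / 5) τ) := by
  have h := oddTheta_three_term (-(2 * τ / 5) - 1 / 5) 0 (-(2 * τ / 5) + 2 / 5) (-(1 / 5)) hτ
  have e1 := oddTheta_add_one (-(2 * τ / 5) - 2 / 5) τ
  have e2 := oddTheta_neg (-(2 * τ / 5) + 2 / 5) τ
  have e3 := oddTheta_neg (1 / 5) τ
  have e4 := oddTheta_add_one (-(3 / 5)) τ
  simp only [torsionTheta]
  push_cast
  ring_nf at h e1 e2 e3 e4 ⊢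
  rw [e1, e2, e3] at h
  rw [e4]
  linear_combination -h

lemma torsionTheta_quartic_first {τ : ℂ} (hτ : 0 < τ.im) :
    torsionTheta (-1) τ * torsionTheta 1 τ ^ 3 - torsionTheta 0 τ ^ 3 * torsionTheta 2 τ =
    -(oddTheta (-(4 * τ / 5) + 1 / 5) τ * oddTheta (1 / 5) τ ^ 3) := by
  have h := oddTheta_three_term (-(2 * τ / 5) + 1 / 5) 0 (-(2 * τ / 5)) (1 / 5) hτ
  have e1 := oddTheta_neg (-(2 * τ / 5)) τ
  simp only [torsionTheta]
  push_cast
  ring_nf at h e1 ⊢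
  rw [e1] at h
  linear_combination h

lemma torsionTheta_quartic_second {τ : ℂ} (hτ : 0 < τ.im) :
    torsionTheta (-1) τ ^ 3 * torsionTheta 0 τ - torsionTheta 1 τ * torsionTheta 2 τ ^ 3 =
    -(oddTheta (-(4 * τ / 5) + 1 / 5) τ * oddTheta (2 / 5) τ ^ 3) := by
  have h := oddTheta_three_term (-(2 * τ / 5) - 1 / 5) 0 (-(2 * τ / 5) + 2 / 5) (-(3 / 5)) hτ
  have e1 := oddTheta_add_one (-(2 * τ / 5)) τ
  have e2 := oddTheta_neg (-(2 * τ / 5) + 2 / 5) τ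
  have e3 := oddTheta_add_one (-(2 * τ / 5) - 4 / 5) τ
  have e4 := oddTheta_add_one (-(3 / 5)) τ
  simp only [torsionTheta]
  push_cast
  ring_nf at h e1 e2 e3 e4 ⊢
  rw [e1, e2] at h
  rw [e3, e4]
  linear_combination -h

lemma differentiableAt_torsionTheta (j : ℤ) {τ : ℂ} (hτ : 0 < τ.im) :
    DifferentiableAt ℂ (torsionTheta j) τ := by
  have hJ : DifferentiableAt ℂ
      (fun τ ↦ jacobiTheta₂ (-(2 * τ / 5) + j / 5 + (1 + τ) / 2) τ) τ :=
    (hasFDerivAt_jacobiTheta₂ (-(2 * τ / 5) + j / 5 + (1 + τ) / 2) hτ).differentiableAt.comp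
      (f := fun τ : ℂ ↦ (-(2 * τ / 5) + j / 5 + (1 + τ) / 2, τ)) τ (by fun_prop)
  unfold torsionTheta oddTheta
  exact DifferentiableAt.mul (by fun_prop) hJ

open Filter Topology in
lemma exists_torsionTheta_neg_two_ne_zero :
    ∃ τ : ℂ, 0 < τ.im ∧ torsionTheta (-2) τ ≠ 0 := by
  have hnorm (t : ℝ) (n : ℤ) : ‖jacobiTheta₂_term n ((t * I + 1) / 10) (t * I)‖ =
      Real.exp (-(Real.pi * (n ^ 2 + n / 5) * t)) := by
    rw [norm_jacobiTheta₂_term]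
    have : ((t * I + 1) / 10 : ℂ).im = t / 10 := by
      rw [show ((t * I + 1) / 10 : ℂ) = ((1 / 10 : ℝ) : ℂ) + ((t / 10 : ℝ) : ℂ) * I by
        push_cast; ring]
      simp
    rw [this, mul_I_im, ofReal_re]
    ring_nf
  have hpos (n : ℤ) (hn : n ≠ 0) : 0 < ((n : ℝ) ^ 2 + n / 5) := by
    have h1 : (1 : ℝ) ≤ (n : ℝ) ^ 2 := by
      have : 0 < n ^ 2 := by positivity
      exact_mod_cast this
    nlinarith [sq_nonneg ((n : ℝ) + 1)]
  have hlim : Tendsto (fun t : ℝ ↦ jacobiTheta₂ ((t * I + 1) / 10) (t * I)) atTop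
      (𝓝 (∑' n : ℤ, if n = 0 then 1 else 0)) := by
    refine tendsto_tsum_of_dominated_convergence
      (bound := fun n ↦ ‖jacobiTheta₂_term n (((1 : ℝ) * I + 1) / 10) ((1 : ℝ) * I)‖)
      ((summable_jacobiTheta₂_term_iff _ _).2 (by simp)).norm (fun n ↦ ?_) ?_
    · split_ifs with hn
      · simp [hn, jacobiTheta₂_term]
      · rw [tendsto_zero_iff_norm_tendsto_zero]
        simp only [hnorm]
        exact Real.tendsto_exp_neg_atTop_nhds_zero.comp
          (tendsto_id.const_mul_atTop (mul_pos Real.pi_pos (hpos n hn)))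
    · filter_upwards [eventually_ge_atTop 1] with t ht n
      rw [hnorm, hnorm]
      rcases eq_or_ne n 0 with rfl | hn
      · simp
      · have := mul_pos Real.pi_pos (hpos n hn)
        gcongr
  rw [tsum_ite_eq] at hlim
  obtain ⟨t, ht, ht0⟩ := ((hlim.eventually_ne one_ne_zero).and (eventually_gt_atTop 0)).exists
  refine ⟨t * I, by simpa using ht0, ?_⟩
  rw [torsionTheta, oddTheta]
  refine mul_ne_zero (Complex.exp_ne_zero _) ?_
  convert ht using 2
  push_cast
  ring

lemma torsionTheta_cubic {τ : ℂ} (hτ : 0 < τ.im) :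
    (torsionTheta (-1) τ * torsionTheta 0 τ ^ 2 + torsionTheta 1 τ ^ 2 * torsionTheta 2 τ) ^ 3 *
      (torsionTheta (-1) τ * torsionTheta 1 τ ^ 3 - torsionTheta 0 τ ^ 3 * torsionTheta 2 τ) =
    (torsionTheta (-1) τ ^ 2 * torsionTheta 1 τ + torsionTheta 0 τ * torsionTheta 2 τ ^ 2) ^ 3 *
      (torsionTheta (-1) τ ^ 3 * torsionTheta 0 τ - torsionTheta 1 τ * torsionTheta 2 τ ^ 3) := by
  have hU : IsOpen {z : ℂ | 0 < z.im} := isOpen_lt continuous_const continuous_im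
  have hd (j : ℤ) : AnalyticOnNhd ℂ (torsionTheta j) {z : ℂ | 0 < z.im} :=
    DifferentiableOn.analyticOnNhd
      (fun z hz ↦ (differentiableAt_torsionTheta j hz).differentiableWithinAt) hU
  have hD := ((((hd (-1)).mul ((hd 0).pow 2)).add (((hd 1).pow 2).mul (hd 2))).pow 3).mul
    (((hd (-1)).mul ((hd 1).pow 3)).sub (((hd 0).pow 3).mul (hd 2))) |>.sub
    ((((((hd (-1)).pow 2).mul (hd 1)).add ((hd 0).mul ((hd 2).pow 2))).pow 3).mul
    ((((hd (-1)).pow 3).mul (hd 0)).sub ((hd 1).mul ((hd 2).pow 3))))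
  refine sub_eq_zero.1 ((AnalyticOnNhd.eq_zero_or_eq_zero_of_mul_eq_zero ((hd (-2)).pow 3) hD
    (fun z hz ↦ ?_) (convex_halfSpace_im_gt 0).isPreconnected).resolve_left ?_ τ hτ)
  · simp only [Pi.pow_apply, Pi.add_apply, Pi.sub_apply]
    rw [mul_sub, ← mul_assoc, ← mul_assoc, ← mul_pow, ← mul_pow,
      torsionTheta_neg_two_mul_first hz, torsionTheta_neg_two_mul_second hz,
      torsionTheta_quartic_first hz, torsionTheta_quartic_second hz]
    ring
  · intro h
    obtain ⟨z, hz, hne⟩ := exists_torsionTheta_neg_two_ne_zero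
    exact pow_ne_zero 3 hne (h z hz)

lemma theta_one_fifth_eq_torsionTheta (j : ℤ) (ε' : ℝ) (hε : ε' = 1 + 2 * j / 5) (τ : ℂ) :
    θ (1 / 5) ε' τ = cexp (Real.pi * I * (41 * τ / 100 + 1 / 10)) *
      cexp (-(4 * Real.pi * I / 25)) ^ j * torsionTheta j τ := by
  rw [θ, torsionTheta, oddTheta, jacobiTheta₂, ← mul_assoc, ← Complex.exp_int_mul,
    ← Complex.exp_add, ← Complex.exp_add, ← tsum_mul_left]
  refine tsum_congr fun n ↦ ?_
  rw [jacobiTheta₂_term, ← Complex.exp_add, hε]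
  push_cast
  ring_nf

theorem theta_identity_cubic (τ : ℂ) (hτ : 0 < τ.im) :
    (θ (1/5) (3/5) τ * θ (1/5) 1 τ ^ 2 + ζ₅ ^ 2 * θ (1/5) (7/5) τ ^ 2 * θ (1/5) (9/5) τ) ^ 3 * (ζ₅ * θ (1/5) (3/5) τ * θ (1/5) (7/5) τ ^ 3 - ζ₅ * θ (1/5) 1 τ ^ 3 * θ (1/5) (9/5) τ) = (ζ₅ ^ 3 * θ (1/5) (3/5) τ ^ 2 * θ (1/5) (7/5) τ + θ (1/5) 1 τ * θ (1/5) (9/5) τ ^ 2) ^ 3 * (θ (1/5) (3/5) τ ^ 3 * θ (1/5) 1 τ - ζ₅ ^ 4 * θ (1/5) (7/5) τ * θ (1/5) (9/5) τ ^ 3) := by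
  have ha := theta_one_fifth_eq_torsionTheta (-1) (3 / 5) (by norm_num) τ
  have hb := theta_one_fifth_eq_torsionTheta 0 1 (by norm_num) τ
  have hc := theta_one_fifth_eq_torsionTheta 1 (7 / 5) (by norm_num) τ
  have hd := theta_one_fifth_eq_torsionTheta 2 (9 / 5) (by norm_num) τ
  have hζ : ζ₅ ^ 2 * cexp (-(4 * Real.pi * I / 25)) ^ 5 = 1 := by
    rw [ζ₅, ← Complex.exp_nat_mul, ← Complex.exp_nat_mul, ← Complex.exp_add, ← Complex.exp_zero]
    push_cast
    ring_nf
  have hζ5 : ζ₅ ^ 5 = 1 := by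
    rw [ζ₅, ← Complex.exp_nat_mul, ← Complex.exp_two_pi_mul_I]
    push_cast
    ring_nf
  have h := torsionTheta_cubic hτ
  have hρ := Complex.exp_ne_zero (-(4 * Real.pi * I / 25))
  rw [ha, hb, hc, hd]
  generalize cexp (-(4 * Real.pi * I / 25)) = ρ at *
  generalize cexp (Real.pi * I * (41 * τ / 100 + 1 / 10)) = K at *
  generalize torsionTheta (-1) τ = a at *
  generalize torsionTheta 0 τ = b at *
  generalize torsionTheta 1 τ = c at *
  generalize torsionTheta 2 τ = d at *
  have hζ' : ζ₅ ^ 3 = ρ ^ 5 := by linear_combination ρ ^ 5 * hζ5 - ζ₅ ^ 3 * hζ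
  have hP : K * ρ ^ (-1 : ℤ) * a * (K * ρ ^ (0 : ℤ) * b) ^ 2 +
      ζ₅ ^ 2 * (K * ρ ^ (1 : ℤ) * c) ^ 2 * (K * ρ ^ (2 : ℤ) * d) =
      K ^ 3 * ρ⁻¹ * (a * b ^ 2 + c ^ 2 * d) := by
    simp only [zpow_neg_one, zpow_ofNat]
    field_simp
    linear_combination K ^ 3 * c ^ 2 * d * hζ
  have hR : ζ₅ ^ 3 * (K * ρ ^ (-1 : ℤ) * a) ^ 2 * (K * ρ ^ (1 : ℤ) * c) +
      K * ρ ^ (0 : ℤ) * b * (K * ρ ^ (2 : ℤ) * d) ^ 2 =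
      K ^ 3 * ρ ^ 4 * (a ^ 2 * c + b * d ^ 2) := by
    simp only [zpow_neg_one, zpow_ofNat]
    field_simp
    linear_combination K ^ 3 * a ^ 2 * c * hζ'
  have hQ : ζ₅ * (K * ρ ^ (-1 : ℤ) * a) * (K * ρ ^ (1 : ℤ) * c) ^ 3 -
      ζ₅ * (K * ρ ^ (0 : ℤ) * b) ^ 3 * (K * ρ ^ (2 : ℤ) * d) =
      K ^ 4 * ζ₅ * ρ ^ 2 * (a * c ^ 3 - b ^ 3 * d) := by
    simp only [zpow_neg_one, zpow_ofNat]
    field_simp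
  have hS : (K * ρ ^ (-1 : ℤ) * a) ^ 3 * (K * ρ ^ (0 : ℤ) * b) -
      ζ₅ ^ 4 * (K * ρ ^ (1 : ℤ) * c) * (K * ρ ^ (2 : ℤ) * d) ^ 3 =
      K ^ 4 * (ρ ^ 3)⁻¹ * (a ^ 3 * b - c * d ^ 3) := by
    simp only [zpow_neg_one, zpow_ofNat]
    field_simp
    linear_combination -(K ^ 4 * c * d ^ 3) * (ζ₅ ^ 2 * ρ ^ 5 + 1) * hζ
  have hphase : ζ₅ * ρ⁻¹ = ρ ^ 9 := by
    field_simp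
    linear_combination (-ζ₅) * hζ5 + (ζ₅ ^ 3 + ρ ^ 5) * hζ'
  rw [hP, hR, hQ, hS]
  calc
    _ = K ^ 13 * (ζ₅ * ρ⁻¹) * ((a * b ^ 2 + c ^ 2 * d) ^ 3 * (a * c ^ 3 - b ^ 3 * d)) := by
      field_simp
    _ = _ := by
      rw [h, hphase]
      field_simp
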